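/- For every k ≥ 0, writing u^{k+1} := (x^{k+1}, w^{k+1}), the KKT residual satisfies ‖R(u^{k+1})‖² ≤ (1/(τ²σ²))‖x^k − x^{k+1}‖² + (2‖Σ_h + S‖/(τσ))‖w^{k+1} − w^k‖²_Θ + 2‖(1 − τ^{−1})A(x^{k+1} − x^k) + d^k‖². -/

import Mathlib

open scoped RealInnerProductSpace
open Filter Topology ContinuousLinearMap

/-- The set of subgradients (in the sense of convex analysis) of an
extended-real-valued function on a real inner product space. -/
def ESubdiff {W : Type*} [NormedAddCommGroup W] [InnerProductSpace ℝ W]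
    (φ : W → EReal) (w : W) : Set W :=
  {d | ∀ u : W, φ w + ((⟪d, u - w⟫ : ℝ) : EReal) ≤ φ u}

/-- Convexity of an extended-real-valued function. -/
def EConvex {W : Type*} [AddCommGroup W] [Module ℝ W] (φ : W → EReal) : Prop :=
  ∀ u v : W, ∀ a b : ℝ, 0 ≤ a → 0 ≤ b → a + b = 1 →
    φ (a • u + b • v) ≤ (a : EReal) * φ u + (b : EReal) * φ v

/-- First-order characterization of convexity for a differentiable function. -/
theorem ConvexOn.add_inner_gradient_le {W : Type*} [NormedAddCommGroup W] [InnerProductSpace ℝ W]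
    [CompleteSpace W] {h : W → ℝ} (hconv : ConvexOn ℝ Set.univ h) {a : W}
    (hdiff : DifferentiableAt ℝ h a) (u : W) :
    h a + ⟪gradient h a, u - a⟫ ≤ h u := by
  have hline : HasDerivAt (fun t : ℝ => h (AffineMap.lineMap a u t)) ⟪gradient h a, u - a⟫ 0 := by
    have hg : HasFDerivAt h (InnerProductSpace.toDual ℝ W (gradient h a))
        (AffineMap.lineMap a u (0 : ℝ)) := by
      simpa using hdiff.hasGradientAt.hasFDerivAt
    exact hg.comp_hasDerivAt (0 : ℝ) AffineMap.hasDerivAt_lineMap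
  have hc : ConvexOn ℝ Set.univ (fun t : ℝ => h (AffineMap.lineMap a u t)) :=
    hconv.comp_affineMap (AffineMap.lineMap a u)
  have := hc.le_slope_of_hasDerivAt (Set.mem_univ 0) (Set.mem_univ 1) zero_lt_one hline
  simp only [slope_def_field, AffineMap.lineMap_apply_one, AffineMap.lineMap_apply_zero, sub_zero,
    div_one] at this
  linarith

/-- Cocoercivity of the gradient of a convex function majorized by a quadratic form, stated
without inverting the quadratic form. -/
theorem ConvexOn.two_mul_inner_gradient_sub_le {W : Type*} [NormedAddCommGroup W]
    [InnerProductSpace ℝ W] [CompleteSpace W] {h : W → ℝ} (hconv : ConvexOn ℝ Set.univ h)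
    (hdiff : Differentiable ℝ h) (Q : W →L[ℝ] W)
    (hmaj : ∀ u v : W, h u ≤ h v + ⟪gradient h v, u - v⟫ + (1 / 2) * ⟪Q (u - v), u - v⟫)
    (a b v : W) :
    2 * ⟪gradient h b - gradient h a, v⟫ - ⟪Q v, v⟫ ≤ ⟪gradient h b - gradient h a, b - a⟫ := by
  have h1 := hconv.add_inner_gradient_le (hdiff a) (b - v)
  have h2 := hconv.add_inner_gradient_le (hdiff b) (a + v)
  have h3 := hmaj (b - v) b
  have h4 := hmaj (a + v) a
  simp only [add_sub_cancel_left, sub_sub_cancel_left, map_neg, inner_neg_left, inner_neg_right,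
    inner_sub_left, inner_sub_right, inner_add_right] at h1 h2 h3 h4 ⊢
  linarith

/-- If `p` is cocoercive along `δ` with respect to `2 M`, then `p - M δ` is controlled by the
quadratic form of `M` at `δ`. -/
theorem norm_sub_apply_sq_le {W : Type*} [NormedAddCommGroup W] [InnerProductSpace ℝ W]
    [CompleteSpace W] {M : W →L[ℝ] W} (hM : IsSelfAdjoint M) {p δ : W}
    (hp : ∀ v, 2 * ⟪p, v⟫ - 2 * ⟪M v, v⟫ ≤ ⟪p, δ⟫) :
    ‖p - M δ‖ ^ 2 ≤ ‖M‖ * ⟪M δ, δ⟫ := by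
  have hsymm (y z : W) : ⟪M y, z⟫ = ⟪M z, y⟫ := by
    rw [real_inner_comm]; exact (hM.isSymmetric z y).symm
  have key (v : W) : 2 * ⟪p - M δ, v⟫ - ⟪M v, v⟫ ≤ ⟪M δ, δ⟫ := by
    have := hp ((1 / 2 : ℝ) • (v + δ))
    have := hsymm v δ
    simp only [map_smul, map_add, inner_smul_left, inner_smul_right, inner_add_left,
      inner_add_right, inner_sub_left, RCLike.conj_to_real] at *
    linarith
  have hq : ⟪M (p - M δ), p - M δ⟫ ≤ ‖M‖ * ‖p - M δ‖ ^ 2 :=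
    calc _ ≤ ‖M (p - M δ)‖ * ‖p - M δ‖ := real_inner_le_norm _ _
      _ ≤ ‖M‖ * ‖p - M δ‖ * ‖p - M δ‖ := by gcongr; exact M.le_opNorm _
      _ = _ := by ring
  rcases (norm_nonneg M).eq_or_lt' with h0 | hpos
  · have hM0 : M = 0 := norm_eq_zero.mp h0
    have := key (p - M δ)
    simp only [hM0, zero_apply, sub_zero, inner_zero_left, norm_zero, zero_mul,
      real_inner_self_eq_norm_sq] at *
    linarith
  · have := key (‖M‖⁻¹ • (p - M δ))
    rw [map_smul, inner_smul_left, inner_smul_right, inner_smul_right,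
      real_inner_self_eq_norm_sq, RCLike.conj_to_real] at this
    have h2 : ‖M‖⁻¹ * (‖M‖⁻¹ * ⟪M (p - M δ), p - M δ⟫) ≤ ‖M‖⁻¹ * ‖p - M δ‖ ^ 2 := by
      gcongr
      rwa [inv_mul_le_iff₀ hpos]
    rw [← inv_mul_le_iff₀ hpos]
    linarith

/-- A minimality condition with a linear and a quadratic perturbation yields a subgradient. -/
theorem EConvex.add_inner_le_of_quadratic {W : Type*} [NormedAddCommGroup W]
    [InnerProductSpace ℝ W] {φ : W → EReal} (hφ : EConvex φ) {w g : W} {a : ℝ} (ha : φ w = a)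
    (q : W → ℝ) (hq : ∀ (t : ℝ) v, q (t • v) = t ^ 2 * q v)
    (hmin : ∀ u, φ w + ((⟪g, u - w⟫ - q (u - w) : ℝ) : EReal) ≤ φ u)
    {u : W} {r : ℝ} (hr : φ u = r) : a + ⟪g, u - w⟫ ≤ r := by
  have step (t : ℝ) (ht0 : 0 < t) (ht1 : t ≤ 1) : a + ⟪g, u - w⟫ - t * q (u - w) ≤ r := by
    have h1 := hmin ((1 - t) • w + t • u)
    have h2 := hφ w u (1 - t) t (by linarith) ht0.le (by ring)
    have h3 : (1 - t) • w + t • u - w = t • (u - w) := by module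
    have h4 := h1.trans h2
    rw [h3, ha, hr, inner_smul_right, hq] at h4
    have h5 : a + (t * ⟪g, u - w⟫ - t ^ 2 * q (u - w)) ≤ (1 - t) * a + t * r := by
      exact_mod_cast h4
    refine le_of_mul_le_mul_left ?_ ht0
    linarith
  have hlim : Tendsto (fun t : ℝ => a + ⟪g, u - w⟫ - t * q (u - w)) (𝓝[>] 0)
      (𝓝 (a + ⟪g, u - w⟫)) := by
    refine tendsto_nhdsWithin_of_tendsto_nhds ?_
    have : Continuous (fun t : ℝ => a + ⟪g, u - w⟫ - t * q (u - w)) := by fun_prop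
    simpa using this.tendsto 0
  refine le_of_tendsto hlim ?_
  filter_upwards [Ioc_mem_nhdsGT (zero_lt_one' ℝ)] with t ht using step t ht.1 ht.2

theorem EReal.add_coe_le_of_add_coe_le {x y : EReal} {r s t : ℝ}
    (h : x + (r : EReal) ≤ y + (s : EReal)) (hrs : t ≤ r - s) : x + (t : EReal) ≤ y := by
  induction x with
  | bot => simp
  | top =>
    rw [top_add_coe, top_le_iff] at h
    induction y with
    | bot => simp at h
    | top => exact le_top
    | coe y => exact absurd (by exact_mod_cast h) (coe_ne_top (y + s))
  | coe x =>
    induction y with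
    | bot =>
      rw [bot_add, le_bot_iff] at h
      exact absurd (by exact_mod_cast h) (coe_ne_bot (x + r))
    | top => exact le_top
    | coe y =>
      norm_cast at *
      linarith

/-- The distance of a point to the proximal image of another point is controlled by any
subgradient at the first point. -/
theorem norm_sub_prox_le {W : Type*} [NormedAddCommGroup W] [InnerProductSpace ℝ W]
    {φ : W → EReal} (hφ : EConvex φ) {w g z p : W} {a : ℝ} (ha : φ w = a) (hp : φ p ≠ ⊥)
    (hg : ∀ (u : W) (r : ℝ), φ u = r → a + ⟪g, u - w⟫ ≤ r)
    (hmin : ∀ u : W, φ p + (((1 / 2) * ‖z - p‖ ^ 2 : ℝ) : EReal)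
        ≤ φ u + (((1 / 2) * ‖z - u‖ ^ 2 : ℝ) : EReal)) :
    ‖w - p‖ ≤ ‖g - (z - w)‖ := by
  have hp' : φ p ≠ ⊤ := by
    intro h
    have := hmin w
    rw [ha, h, EReal.top_add_coe, top_le_iff] at this
    exact EReal.coe_ne_top _ (by exact_mod_cast this)
  lift φ p to ℝ using ⟨hp', hp⟩ with b hb
  have h1 := hg p b hb.symm
  have h2 : b + ⟪z - p, w - p⟫ ≤ a := by
    refine hφ.add_inner_le_of_quadratic hb.symm (fun v => (1 / 2) * ‖v‖ ^ 2) (fun t v => ?_)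
      (fun u => ?_) ha
    · rw [norm_smul, mul_pow, Real.norm_eq_abs, sq_abs]; ring
    · rw [← hb]
      refine EReal.add_coe_le_of_add_coe_le (hmin u) ?_
      have : z - u = (z - p) - (u - p) := by abel
      rw [this, norm_sub_sq_real (z - p)]
      linarith
  have h3 : ‖w - p‖ ^ 2 ≤ ⟪g - (z - w), w - p⟫ := by
    have e1 : p - w = -(w - p) := by abel
    have e2 : z - p = (z - w) + (w - p) := by abel
    rw [e1, inner_neg_right] at h1
    rw [e2, inner_add_left, real_inner_self_eq_norm_sq] at h2
    rw [inner_sub_left]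
    linarith
  have h4 := real_inner_le_norm (g - (z - w)) (w - p)
  rcases (norm_nonneg (w - p)).eq_or_lt' with h0 | hpos
  · rw [h0]; positivity
  · refine le_of_mul_le_mul_right ?_ hpos
    linarith

/-- For every `k ≥ 0`, writing `u^{k+1} := (x^{k+1}, w^{k+1})`, the KKT
residual `R(x,w) := (c - A*w, w - Prox_φ(w - ∇h(w) - Ax))` satisfies
`‖R(u^{k+1})‖² ≤ (1/(τ²σ²))‖x^k - x^{k+1}‖² + (2‖Σ_h+S‖/(τσ))‖w^{k+1} - w^k‖²_Θ
  + 2‖(1 - τ⁻¹)A(x^{k+1} - x^k) + d^k‖²`. -/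
theorem stmt_8
    {X W : Type*} [NormedAddCommGroup X] [InnerProductSpace ℝ X] [FiniteDimensional ℝ X]
    [NormedAddCommGroup W] [InnerProductSpace ℝ W] [FiniteDimensional ℝ W]
    -- `φ` is a closed proper convex function on `W`
    (φ : W → EReal) (hφconv : EConvex φ) (hφlsc : LowerSemicontinuous φ)
    (hφbot : ∀ v, φ v ≠ ⊥) (hφtop : ∃ v, φ v ≠ ⊤)
    -- `h` is a convex continuously differentiable function on `W`
    (h : W → ℝ) (hhconv : ConvexOn ℝ Set.univ h) (hhdiff : ContDiff ℝ 1 h)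
    -- problem data, penalty parameter and step-length
    (A : X →L[ℝ] W) (c : X) (σ τ : ℝ) (hσ : 0 < σ) (hτ0 : 0 < τ) (hτ2 : τ < 2)
    -- the majorization operator `Σ_h` (here `Sig`), self-adjoint positive semidefinite
    (Sig S : W →L[ℝ] W) (hSigsa : IsSelfAdjoint Sig) (hSigpsd : ∀ v : W, 0 ≤ ⟪Sig v, v⟫)
    (hmaj : ∀ u v : W, h u ≤ h v + ⟪gradient h v, u - v⟫
      + (1 / 2) * ⟪Sig (u - v), u - v⟫)
    -- the proximal operator `S`: self-adjoint, `S ⪰ -(1/2)Σ_h`,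
    -- and `(1/2)Σ_h + σAA* + S ≻ 0`
    (hSsa : IsSelfAdjoint S)
    (hS1 : ∀ v : W, -(1 / 2) * ⟪Sig v, v⟫ ≤ ⟪S v, v⟫)
    (hS2 : ∀ v : W, v ≠ 0 →
      0 < (1 / 2) * ⟪Sig v, v⟫ + σ * ‖A.adjoint v‖ ^ 2 + ⟪S v, v⟫)
    -- the KKT system has a solution
    (hKKT : ∃ (xs : X) (ws : W),
      -(gradient h ws) - A xs ∈ ESubdiff φ ws ∧ A.adjoint ws = c)
    -- the iPALM iterates: errors, primal and dual sequences
    (ε : ℕ → ℝ) (hε : ∀ k, 0 ≤ ε k) (hεsum : Summable ε)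
    (x : ℕ → X) (w : ℕ → W) (d : ℕ → W)
    (hd : ∀ k, ‖d k‖ ≤ ε k)
    -- `d^k ∈ ∂_w L_σ(w^{k+1}; (x^k, w^k)) + S(w^{k+1} - w^k)`
    (hsub : ∀ k : ℕ, d k - S (w (k + 1) - w k) ∈
      ESubdiff (fun v : W =>
        φ v + ((h (w k) + ⟪gradient h (w k), v - w k⟫
          + (1 / 2) * ⟪Sig (v - w k), v - w k⟫
          + ⟪A.adjoint v - c, x k⟫
          + (σ / 2) * ‖A.adjoint v - c‖ ^ 2 : ℝ) : EReal)) (w (k + 1)))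
    -- `x^{k+1} = x^k + τσ(A* w^{k+1} - c)`
    (hx : ∀ k : ℕ, x (k + 1) = x k + (τ * σ) • (A.adjoint (w (k + 1)) - c))
    -- `prox` is the Moreau-Yosida proximal mapping of `φ`:
    -- `prox v` is the unique minimizer of `w' ↦ φ(w') + (1/2)‖v - w'‖²`
    (prox : W → W)
    (hproxmin : ∀ v u : W,
      φ (prox v) + (((1 / 2) * ‖v - prox v‖ ^ 2 : ℝ) : EReal)
        ≤ φ u + (((1 / 2) * ‖v - u‖ ^ 2 : ℝ) : EReal))
    (hproxuniq : ∀ v u : W,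
      (∀ u' : W, φ u + (((1 / 2) * ‖v - u‖ ^ 2 : ℝ) : EReal)
        ≤ φ u' + (((1 / 2) * ‖v - u'‖ ^ 2 : ℝ) : EReal)) → u = prox v)
    :
    let Th : W →L[ℝ] W := (τ * σ) •
      (Sig + S + (((2 - τ) * σ / 3 : ℝ)) • (A ∘L A.adjoint))
    ∀ k : ℕ,
      ‖c - A.adjoint (w (k + 1))‖ ^ 2
        + ‖w (k + 1) - prox (w (k + 1) - gradient h (w (k + 1)) - A (x (k + 1)))‖ ^ 2
      ≤ (1 / (τ ^ 2 * σ ^ 2)) * ‖x k - x (k + 1)‖ ^ 2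
        + (2 * ‖Sig + S‖ / (τ * σ)) * ⟪Th (w (k + 1) - w k), w (k + 1) - w k⟫
        + 2 * ‖(1 - τ⁻¹) • A (x (k + 1) - x k) + d k‖ ^ 2 := by
  intro Th k
  set δ := w (k + 1) - w k with hδ
  set ρ := A.adjoint (w (k + 1)) - c with hρ
  have hxk : x (k + 1) - x k = (τ * σ) • ρ := by rw [hx k]; abel
  set e := (1 - τ⁻¹) • A (x (k + 1) - x k) + d k with he
  -- the subgradient of `φ` at the new iterate
  set g := e - gradient h (w k) - (Sig + S) δ - A (x (k + 1)) with hg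
  have hge : g = d k - S δ - gradient h (w k) - Sig δ - A (x k) - σ • A ρ := by
    have : A (x (k + 1)) = A (x k) + (τ * σ) • A ρ := by
      rw [← map_smul, ← map_add, ← hxk]; congr 1; abel
    rw [hg, he, hxk, this, map_smul, smul_smul,
      show (1 - τ⁻¹) * (τ * σ) = τ * σ - σ by field_simp, add_apply]
    module
  have hwtop : φ (w (k + 1)) ≠ ⊤ := by
    intro htop
    obtain ⟨v, hv⟩ := hφtop
    have := hsub k v
    simp only [htop, EReal.top_add_coe, top_le_iff] at this
    lift φ v to ℝ using ⟨hv, hφbot v⟩ with b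
    exact EReal.coe_ne_top _ (by exact_mod_cast this)
  obtain ⟨a, ha⟩ : ∃ a : ℝ, φ (w (k + 1)) = a :=
    ⟨_, (EReal.coe_toReal hwtop (hφbot _)).symm⟩
  have hgsub (u : W) (r : ℝ) (hr : φ u = r) : a + ⟪g, u - w (k + 1)⟫ ≤ r := by
    refine hφconv.add_inner_le_of_quadratic ha
      (fun v => (1 / 2) * ⟪Sig v, v⟫ + (σ / 2) * ‖A.adjoint v‖ ^ 2) (fun t v => ?_)
      (fun u => ?_) hr
    · simp only [map_smul, inner_smul_left, inner_smul_right, norm_smul, mul_pow,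
        Real.norm_eq_abs, sq_abs, RCLike.conj_to_real]
      ring
    · have hsu := hsub k u
      simp only [add_assoc, ← EReal.coe_add, ← hδ, ← hρ] at hsu
      refine EReal.add_coe_le_of_add_coe_le hsu ?_
      set y := u - w (k + 1) with hy
      have e1 : u - w k = δ + y := by rw [hδ, hy]; abel
      have e2 : A.adjoint u - c = ρ + A.adjoint y := by rw [hρ, hy, map_sub]; abel
      have e3 : ∀ z, ⟪A z, y⟫ = ⟪A.adjoint y, z⟫ := fun z => by
        rw [real_inner_comm, adjoint_inner_left]
      have e4 : ⟪Sig y, δ⟫ = ⟪Sig δ, y⟫ :=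
        (hSigsa.isSymmetric y δ).trans (real_inner_comm (Sig δ) y)
      have e5 := real_inner_comm ρ (A.adjoint y)
      rw [e1, e2, hge, norm_add_sq_real ρ]
      simp only [map_add, inner_add_left, inner_add_right, inner_sub_left, inner_smul_left,
        RCLike.conj_to_real, e3, e5]
      linarith
  have hres := norm_sub_prox_le hφconv ha (hφbot _) hgsub
    (hproxmin (w (k + 1) - gradient h (w (k + 1)) - A (x (k + 1))))
  set P := prox (w (k + 1) - gradient h (w (k + 1)) - A (x (k + 1)))
  set p := gradient h (w (k + 1)) - gradient h (w k) with hp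
  have hsplit : g - (w (k + 1) - gradient h (w (k + 1)) - A (x (k + 1)) - w (k + 1))
      = e + (p - (Sig + S) δ) := by rw [hg, hp]; abel
  rw [hsplit] at hres
  have hcoc : ‖p - (Sig + S) δ‖ ^ 2 ≤ ‖Sig + S‖ * ⟪(Sig + S) δ, δ⟫ := by
    refine norm_sub_apply_sq_le (hSigsa.add hSsa) fun v => ?_
    have h1 := hhconv.two_mul_inner_gradient_sub_le (hhdiff.differentiable one_ne_zero) Sig hmaj
      (w k) (w (k + 1)) v
    have h2 := hS1 v
    rw [add_apply, inner_add_left]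
    linarith
  have hsq : ‖w (k + 1) - P‖ ^ 2 ≤ 2 * ‖e‖ ^ 2 + 2 * ‖p - (Sig + S) δ‖ ^ 2 :=
    calc ‖w (k + 1) - P‖ ^ 2 ≤ (‖e‖ + ‖p - (Sig + S) δ‖) ^ 2 := by
          gcongr; exact hres.trans (norm_add_le _ _)
      _ ≤ _ := by linarith [sq_nonneg (‖e‖ - ‖p - (Sig + S) δ‖)]
  have hprimal : (1 / (τ ^ 2 * σ ^ 2)) * ‖x k - x (k + 1)‖ ^ 2
      = ‖c - A.adjoint (w (k + 1))‖ ^ 2 := by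
    rw [norm_sub_rev (x k), hxk, norm_sub_rev c, ← hρ, norm_smul, mul_pow, Real.norm_eq_abs, sq_abs]
    field_simp
  have hTh : (2 * ‖Sig + S‖ / (τ * σ)) * ⟪Th δ, δ⟫ = 2 * (‖Sig + S‖ * ⟪(Sig + S) δ, δ⟫)
      + 2 * ‖Sig + S‖ * ((2 - τ) * σ / 3 * ‖A.adjoint δ‖ ^ 2) := by
    have : ⟪A (A.adjoint δ), δ⟫ = ‖A.adjoint δ‖ ^ 2 := by
      rw [← adjoint_inner_right, real_inner_self_eq_norm_sq]
    simp only [Th, smul_apply, add_apply (Sig + S), comp_apply, inner_smul_left,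
      inner_add_left (_ : W) ((_ : ℝ) • (_ : W)), RCLike.conj_to_real, this]
    field_simp
  have hnn : 0 ≤ 2 * ‖Sig + S‖ * ((2 - τ) * σ / 3 * ‖A.adjoint δ‖ ^ 2) := by
    have := sub_pos.mpr hτ2
    positivity
  rw [hprimal, hTh]
  linarith
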